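/- There exists an absolute constant C > 0 with the following property: for every odd prime p and every Dirichlet character χ modulo p with χ² ≠ χ₀, if for every Dirichlet character ψ modulo p every zero s of L(s,ψ) with 0 < Re(s) < 1 satisfies Re(s) = 1/2, then for all real x ≥ 2 one has | ∑_{m ∈ S, m ≤ x} χ(m) | ≤ C · x^{1/3} · (log(p·x))². -/

import Mathlib

/-- `S` is the set of positive integers of the form `q² r³` with `q, r` prime. -/
def memS (m : ℕ) : Prop := ∃ q r : ℕ, q.Prime ∧ r.Prime ∧ m = q ^ 2 * r ^ 3

section

open Set Filter Topology MeasureTheory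

theorem DirichletCharacter.sum_range_mul_eq_zero {N : ℕ} [NeZero N] {ψ : DirichletCharacter ℂ N}
    (hψ : ψ ≠ 1) (m : ℕ) : ∑ k ∈ Finset.range (N * m), ψ (k : ZMod N) = 0 := by
  have period : ∑ k ∈ Finset.range N, ψ (k : ZMod N) = 0 := by
    rw [← MulChar.sum_eq_zero_of_ne_one hψ]
    refine Finset.sum_bij' (fun k _ => (k : ZMod N)) (fun a _ => a.val) ?_ ?_ ?_ ?_ ?_
    · simp
    · intro a _
      simpa using ZMod.val_lt a
    · intro k hk
      exact ZMod.val_cast_of_lt (Finset.mem_range.mp hk)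
    · simp
    · simp
  induction m with
  | zero => simp
  | succ m ih =>
    rw [Nat.mul_succ, Finset.sum_range_add, ih, zero_add, ← period]
    exact Finset.sum_congr rfl fun k _ => by simp

theorem DirichletCharacter.norm_sum_Icc_le {N : ℕ} [NeZero N] {ψ : DirichletCharacter ℂ N}
    (hψ : ψ ≠ 1) (n : ℕ) : ‖∑ k ∈ Finset.Icc 1 n, ψ (k : ZMod N)‖ ≤ N := by
  have hN : N ≠ 1 := by
    rintro rfl
    exact hψ (DirichletCharacter.level_one ψ)
  have zero_term : ψ ((0 : ℕ) : ZMod N) = 0 := by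
    have : Nontrivial (ZMod N) := ZMod.nontrivial_iff.mpr hN
    rw [Nat.cast_zero, MulChar.map_zero]
  have hIcc : ∑ k ∈ Finset.Icc 1 n, ψ (k : ZMod N) =
      ∑ k ∈ Finset.range (n + 1), ψ (k : ZMod N) := by
    rw [Finset.range_eq_Ico, Finset.sum_eq_sum_Ico_succ_bot (Nat.succ_pos n), zero_term, zero_add]
    rfl
  rw [hIcc, ← Nat.div_add_mod (n + 1) N, Finset.sum_range_add, sum_range_mul_eq_zero hψ, zero_add]
  refine (norm_sum_le_of_le _ fun k _ => ψ.norm_le_one _).trans ?_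
  simpa using (Nat.mod_lt _ (NeZero.pos N)).le

theorem DirichletCharacter.LFunction_eq_mul_integral {N : ℕ} [NeZero N]
    {ψ : DirichletCharacter ℂ N} (hψ : ψ ≠ 1) {s : ℂ} (hs : 0 < s.re) :
    ψ.LFunction s =
      s * ∫ t in Ioi (1 : ℝ), (∑ k ∈ Finset.Icc 1 ⌊t⌋₊, ψ (k : ZMod N)) * (t : ℂ) ^ (-(s + 1)) := by
  set S : ℝ → ℂ := fun t => ∑ k ∈ Finset.Icc 1 ⌊t⌋₊, ψ (k : ZMod N) with hS
  have bound (t : ℝ) : ‖S t‖ ≤ N := norm_sum_Icc_le hψ _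
  have meas : Measurable S :=
    (measurable_from_nat (f := fun n => ∑ k ∈ Finset.Icc 1 n, ψ (k : ZMod N))).comp
      Nat.measurable_floor
  set f : ℝ → ℂ := (Ioi 1).indicator S with hf
  have fbound (t : ℝ) : ‖f t‖ ≤ N := (norm_indicator_le_norm_self _ _).trans (bound t)
  have fmeas : Measurable f := meas.indicator measurableSet_Ioi
  have integral_eq (z : ℂ) :
      ∫ t in Ioi (1 : ℝ), S t * (t : ℂ) ^ (-(z + 1)) = mellin f (-z) := by
    rw [mellin, ← integral_indicator measurableSet_Ioi, ← integral_indicator measurableSet_Ioi]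
    congr 1
    ext t
    by_cases ht : 1 < t
    · have : t ∈ Ioi (0 : ℝ) := by simp only [mem_Ioi]; linarith
      rw [indicator_of_mem (by exact ht), indicator_of_mem this, hf, indicator_of_mem (by exact ht),
        smul_eq_mul, mul_comm]
      congr 2
      ring
    · rw [indicator_of_notMem (by exact ht)]
      by_cases h0 : t ∈ Ioi (0 : ℝ)
      · rw [indicator_of_mem h0, hf, indicator_of_notMem (by exact ht), smul_zero]
      · rw [indicator_of_notMem h0]
  have loc : LocallyIntegrableOn f (Ioi 0) :=
    (memLp_top_of_bound fmeas.aestronglyMeasurable N (Eventually.of_forall fbound)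
      |>.locallyIntegrable le_top).locallyIntegrableOn _
  have hdiff : DifferentiableOn ℂ (fun z => z * mellin f (-z)) {z : ℂ | 0 < z.re} := by
    intro z hz
    refine DifferentiableAt.differentiableWithinAt ?_
    have key : DifferentiableAt ℂ (mellin f) (-z) := by
      refine mellin_differentiableAt_of_isBigO_rpow (a := 0) (b := (-z).re - 1) loc ?_ ?_ ?_ ?_
      · exact Asymptotics.IsBigO.of_bound N (Eventually.of_forall fun t => by simpa using fbound t)
      · simpa using hz
      · refine Asymptotics.IsBigO.of_bound 0 ?_
        filter_upwards [Ioo_mem_nhdsGT (zero_lt_one (α := ℝ))] with t ht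
        rw [hf, indicator_of_notMem (by simpa using ht.2.le)]
        simp
      · linarith
    exact differentiableAt_id.mul (key.comp z differentiableAt_id.neg)
  have hopen : IsOpen {z : ℂ | 0 < z.re} := isOpen_lt continuous_const Complex.continuous_re
  have hconn : IsPreconnected {z : ℂ | 0 < z.re} := (convex_halfSpace_re_gt 0).isPreconnected
  have eqOn : EqOn ψ.LFunction (fun z => z * mellin f (-z)) {z : ℂ | 0 < z.re} := by
    refine AnalyticOnNhd.eqOn_of_preconnected_of_eventuallyEq (z₀ := 2)
      ((differentiable_LFunction hψ).differentiableOn.analyticOnNhd hopen)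
      (hdiff.analyticOnNhd hopen) hconn (by simp) ?_
    have : {z : ℂ | 1 < z.re} ∈ 𝓝 (2 : ℂ) :=
      (isOpen_lt continuous_const Complex.continuous_re).mem_nhds (by simp)
    filter_upwards [this] with z hz
    rw [LFunction_eq_LSeries ψ hz, LSeries_eq_mul_integral (fun n : ℕ => ψ (n : ZMod N)) (r := 0) le_rfl
      (zero_lt_one.trans hz)
      (LSeriesSummable_of_one_lt_re ψ hz), ← integral_eq]
    exact Asymptotics.IsBigO.of_bound N
      (Eventually.of_forall fun n => by simpa using norm_sum_Icc_le hψ n)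
  rw [integral_eq]
  exact eqOn hs

theorem DirichletCharacter.norm_LFunction_le {N : ℕ} [NeZero N]
    {ψ : DirichletCharacter ℂ N} (hψ : ψ ≠ 1) {s : ℂ} (hs : 1 / 2 ≤ s.re) :
    ‖ψ.LFunction s‖ ≤ 2 * N * ‖s‖ := by
  have hs0 : 0 < s.re := by linarith
  rw [LFunction_eq_mul_integral hψ hs0, norm_mul, mul_comm]
  gcongr
  have hG_int : IntegrableOn (fun t : ℝ => N * t ^ (-(s.re + 1))) (Ioi 1) :=
    (integrableOn_Ioi_rpow_of_lt (by linarith) zero_lt_one).const_mul _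
  calc _ ≤ ∫ t in Ioi (1 : ℝ), N * t ^ (-(s.re + 1)) := by
        refine norm_integral_le_of_norm_le hG_int ?_
        filter_upwards [ae_restrict_mem measurableSet_Ioi] with t ht
        have ht' : (0 : ℝ) < t := zero_lt_one.trans ht
        rw [norm_mul, Complex.norm_cpow_eq_rpow_re_of_pos ht']
        simp only [Complex.neg_re, Complex.add_re, Complex.one_re]
        gcongr
        exact norm_sum_Icc_le hψ _
    _ = N * (1 / s.re) := by
        rw [integral_const_mul, integral_Ioi_rpow_of_lt (by linarith) zero_lt_one]
        simp only [Real.one_rpow]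
        congr 1
        rw [show -(s.re + 1) + 1 = -s.re by ring, neg_div_neg_eq]
    _ ≤ N * 2 := by
        gcongr
        rw [div_le_iff₀ hs0]
        linarith
    _ = 2 * N := mul_comm _ _

theorem DirichletCharacter.half_le_norm_LFunction {N : ℕ} [NeZero N]
    (ψ : DirichletCharacter ℂ N) {s : ℂ} (hs : s.re = 2) : 1 / 2 ≤ ‖ψ.LFunction s‖ := by
  have hs1 : 1 < s.re := by rw [hs]; norm_num
  set g : ℕ → ℂ := (fun n : ℕ => ψ (n : ZMod N)) * fun n => (ArithmeticFunction.moebius n : ℂ)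
  have hmul : ψ.LFunction s * LSeries g s = 1 := by
    rw [LFunction_eq_LSeries ψ hs1]
    exact LSeries.mul_mu_eq_one ψ hs1
  have hg : ‖LSeries g s‖ ≤ 2 := by
    refine (tsum_of_norm_bounded hasSum_zeta_two fun n => ?_).trans ?_
    · rcases eq_or_ne n 0 with rfl | hn
      · simp
      rw [LSeries.norm_term_eq, if_neg hn, hs]
      norm_cast
      gcongr
      have h1 := ψ.norm_le_one (n : ZMod N)
      have h2 : ‖((ArithmeticFunction.moebius n : ℤ) : ℂ)‖ ≤ 1 := by
        rw [Complex.norm_intCast]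
        exact_mod_cast ArithmeticFunction.abs_moebius_le_one
      simpa [g] using mul_le_one₀ h1 (norm_nonneg _) h2
    · nlinarith [Real.pi_lt_d2, Real.pi_pos]
  have := congrArg norm hmul
  rw [norm_mul, norm_one] at this
  nlinarith [norm_nonneg (ψ.LFunction s)]

theorem Complex.norm_logDeriv_le_of_norm_le_exp {f : ℂ → ℂ} {c z : ℂ} {r d M : ℝ}
    (hr : 0 < r) (hd : 0 < d) (hM : 0 < M) (hf : DifferentiableOn ℂ f (Metric.ball c (r + 2 * d)))
    (hf0 : ∀ w ∈ Metric.ball c (r + 2 * d), f w ≠ 0)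
    (hfM : ∀ w ∈ Metric.ball c (r + 2 * d), ‖f w‖ ≤ Real.exp M * ‖f c‖)
    (hz : z ∈ Metric.closedBall c r) :
    ‖deriv f z / f z‖ ≤ 2 * M * (r + d) / d / d := by
  set B := Metric.ball c (r + 2 * d) with hB
  have hBo : IsOpen B := Metric.isOpen_ball
  have hcB : c ∈ B := Metric.mem_ball_self (by linarith)
  have hder : DifferentiableOn ℂ (fun w => deriv f w / f w) B :=
    (hf.deriv hBo).div hf hf0
  obtain ⟨g, hgc, hg⟩ := hder.isExactOn_ball.with_val_at c 0
  have hgd : DifferentiableOn ℂ g B := fun w hw => (hg w hw).differentiableAt.differentiableWithinAt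
  have hconst : ∀ w ∈ B, f w * Complex.exp (-g w) = f c := by
    intro w hw
    have h0 : ∀ u ∈ B, HasDerivAt (fun u => f u * Complex.exp (-g u)) 0 u := by
      intro u hu
      have h1 := (hf.differentiableAt (hBo.mem_nhds hu)).hasDerivAt
      have h2 := (hg u hu).neg.cexp
      have h3 := hf0 u hu
      refine (h1.mul h2).congr_deriv ?_
      simp only [Pi.neg_apply]
      field_simp
      ring
    have := hBo.is_const_of_deriv_eq_zero (convex_ball c _).isPreconnected
      (fun u hu => (h0 u hu).differentiableAt.differentiableWithinAt)
      (fun u hu => (h0 u hu).deriv) hw hcB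
    simpa [hgc] using this
  have hre : ∀ w ∈ B, (g w).re ≤ M := by
    intro w hw
    have h1 : f w = f c * Complex.exp (g w) := by
      rw [← hconst w hw, mul_assoc, ← Complex.exp_add]
      simp
    have h2 := hfM w hw
    rw [h1, norm_mul, mul_comm, Complex.norm_exp] at h2
    exact Real.exp_le_exp.mp (le_of_mul_le_mul_right h2 (norm_pos_iff.mpr (hf0 c hcB)))
  have hgbound : ∀ w ∈ Metric.closedBall c (r + d), ‖g w‖ ≤ 2 * M * (r + d) / d := by
    intro w hw
    have hw' : ‖w - c‖ ≤ r + d := by simpa [dist_eq_norm] using hw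
    have maps : MapsTo (fun u => c + u) (Metric.ball 0 (r + 2 * d)) B := by
      intro u hu
      simpa [hB, dist_eq_norm] using hu
    have := Complex.borelCaratheodory_zero (f := fun u => g (c + u)) (z := w - c) hM
      (hgd.comp (by fun_prop) maps) (fun u hu => hre _ (maps hu)) (by linarith)
      (by rw [mem_ball_zero_iff]; linarith) (by simpa using hgc)
    simp only [add_sub_cancel] at this
    refine this.trans ?_
    gcongr
    linarith
  have hzc : dist z c ≤ r := hz
  have hsub : Metric.closedBall z d ⊆ Metric.closedBall c (r + d) :=
    Metric.closedBall_subset_closedBall' (by linarith)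
  have hsubB : Metric.closedBall c (r + d) ⊆ B := Metric.closedBall_subset_ball (by linarith)
  have hzB : z ∈ B := hsubB (hsub (Metric.mem_closedBall_self hd.le))
  rw [← (hg z hzB).deriv]
  refine Complex.norm_deriv_le_of_forall_mem_sphere_norm_le hd ?_ fun w hw =>
    hgbound w (hsub (Metric.sphere_subset_closedBall hw))
  exact (hgd.mono (hsub.trans hsubB)).diffContOnCl_ball subset_rfl

theorem DirichletCharacter.norm_logDeriv_LFunction_le_log {N : ℕ} [NeZero N]
    {ψ : DirichletCharacter ℂ N} (hψ : ψ ≠ 1) (hψ0 : ∀ s : ℂ, 1 / 2 < s.re → ψ.LFunction s ≠ 0)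
    {s : ℂ} (hs : 3 / 5 ≤ s.re) (hs2 : s.re ≤ 2) :
    ‖deriv ψ.LFunction s / ψ.LFunction s‖ ≤ 1200 * Real.log (4 * N * (|s.im| + 4)) := by
  set c : ℂ := ⟨2, s.im⟩
  have hN : (1 : ℝ) ≤ N := by exact_mod_cast NeZero.one_le
  have hpos : 1 < 4 * N * (|s.im| + 4) := by nlinarith [abs_nonneg s.im]
  have hre : ∀ w ∈ Metric.ball c (7 / 5 + 2 * (1 / 20)), 1 / 2 < w.re ∧ ‖w‖ ≤ |s.im| + 4 := by
    intro w hw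
    rw [Metric.mem_ball, dist_eq_norm] at hw
    have h1 := (Complex.abs_re_le_norm (w - c)).trans_lt hw
    have h2 : ‖c‖ ≤ 2 + |s.im| := by simpa [c] using Complex.norm_le_abs_re_add_abs_im c
    have h3 : ‖w‖ ≤ ‖w - c‖ + ‖c‖ := norm_le_norm_sub_add w c
    rw [Complex.sub_re, abs_lt] at h1
    constructor
    · have : c.re = 2 := rfl
      linarith [h1.1]
    · linarith
  have key := Complex.norm_logDeriv_le_of_norm_le_exp (f := ψ.LFunction) (c := c) (z := s)
    (r := 7 / 5) (d := 1 / 20) (M := Real.log (4 * N * (|s.im| + 4))) (by norm_num) (by norm_num)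
    (Real.log_pos hpos) (differentiable_LFunction hψ).differentiableOn
    (fun w hw => hψ0 w (hre w hw).1) ?_ ?_
  · refine key.trans ?_
    have := Real.log_pos hpos
    linarith
  · intro w hw
    rw [Real.exp_log (by linarith)]
    have h1 := norm_LFunction_le hψ (hre w hw).1.le
    have h2 := half_le_norm_LFunction ψ (s := c) rfl
    have h3 := (hre w hw).2
    calc ‖ψ.LFunction w‖ ≤ 2 * N * ‖w‖ := h1
      _ ≤ 2 * N * (|s.im| + 4) := by gcongr
      _ = 4 * N * (|s.im| + 4) * (1 / 2) := by ring
      _ ≤ _ := by gcongr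
  · rw [Metric.mem_closedBall, dist_eq_norm]
    have : s - c = ((s.re - 2 : ℝ) : ℂ) := by
      apply Complex.ext <;> simp [c]
    rw [this, Complex.norm_real, Real.norm_eq_abs, abs_le]
    constructor <;> linarith

theorem DirichletCharacter.exists_norm_logDeriv_LFunction_le :
    ∃ A : ℝ, 0 < A ∧ ∀ (N : ℕ) [NeZero N], 3 ≤ N → ∀ ψ : DirichletCharacter ℂ N, ψ ≠ 1 →
      (∀ s : ℂ, 1 / 2 < s.re → ψ.LFunction s ≠ 0) → ∀ s : ℂ, 3 / 5 ≤ s.re → s.re ≤ 2 →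
      ‖deriv ψ.LFunction s / ψ.LFunction s‖ ≤
        A * Real.log N * (1 + |s.im|) ^ (1 / 40 : ℝ) := by
  refine ⟨1200 * 52, by norm_num, fun N _ hN ψ hψ hψ0 s hs hs2 => ?_⟩
  refine (norm_logDeriv_LFunction_le_log hψ hψ0 hs hs2).trans ?_
  have hN' : (3 : ℝ) ≤ N := by exact_mod_cast hN
  set T := 1 + |s.im| with hT
  have hT1 : 1 ≤ T := by linarith [abs_nonneg s.im]
  have hlogN : 1 ≤ Real.log N := by
    rw [Real.le_log_iff_exp_le (by linarith)]
    linarith [Real.exp_one_lt_d9]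
  have hTpow : 1 ≤ T ^ (1 / 40 : ℝ) := Real.one_le_rpow hT1 (by norm_num)
  have hlogT : Real.log T ≤ T ^ (1 / 40 : ℝ) / (1 / 40) :=
    Real.log_le_rpow_div (by linarith) (by norm_num)
  have hle : Real.log (4 * N * (|s.im| + 4)) ≤ Real.log (N ^ 4 * T) := by
    apply Real.log_le_log
    · positivity
    · have h1 : |s.im| + 4 ≤ 4 * T := by linarith [abs_nonneg s.im]
      have h2 : (16 : ℝ) * N ≤ N ^ 4 := by
        have : (16 : ℝ) ≤ N ^ 3 := by nlinarith [pow_le_pow_left₀ (by norm_num) hN' 3]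
        nlinarith
      nlinarith
  rw [Real.log_mul (x := (N : ℝ) ^ 4) (by positivity) (by positivity), Real.log_pow] at hle
  push_cast at hle
  have h3 : Real.log N ≤ Real.log N * T ^ (1 / 40 : ℝ) := le_mul_of_one_le_right (by linarith) hTpow
  have h4 : T ^ (1 / 40 : ℝ) ≤ Real.log N * T ^ (1 / 40 : ℝ) :=
    le_mul_of_one_le_left (by linarith) hlogN
  nlinarith

theorem Complex.one_add_abs_im_le_three_mul_norm {s : ℂ} (hs : 3 / 5 ≤ s.re) :
    1 + |s.im| ≤ 3 * ‖s‖ := by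
  have h1 := Complex.abs_im_le_norm s
  have h2 := (le_abs_self _).trans (Complex.abs_re_le_norm s)
  linarith

theorem Complex.norm_mul_add_one_inv_le {s : ℂ} (hs : 3 / 5 ≤ s.re) :
    ‖1 / (s * (s + 1))‖ ≤ 9 * (1 + |s.im|) ^ (-2 : ℝ) := by
  have h1 := one_add_abs_im_le_three_mul_norm hs
  have h2 : 1 + |s.im| ≤ 3 * ‖s + 1‖ := by
    have := one_add_abs_im_le_three_mul_norm (s := s + 1) (by simp; linarith)
    simpa using this
  have h0 : 0 < 1 + |s.im| := by positivity
  rw [norm_div, norm_one, norm_mul, Real.rpow_neg h0.le, ← div_eq_mul_inv,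
    div_le_div_iff₀ (by nlinarith) (by positivity)]
  norm_cast
  nlinarith

theorem integrable_one_add_abs_rpow {r : ℝ} (hr : r < -1) :
    Integrable fun t : ℝ => (1 + |t|) ^ r := by
  have := integrable_one_add_norm (E := ℝ) (μ := volume) (r := -r) (by simp; linarith)
  simpa using this

theorem integrable_mul_add_one_inv {σ : ℝ} (hσ : 3 / 5 ≤ σ) :
    Integrable fun t : ℝ => 1 / (((σ : ℂ) + t * Complex.I) * (σ + t * Complex.I + 1)) := by
  have hcont : Continuous fun t : ℝ =>
      1 / (((σ : ℂ) + t * Complex.I) * (σ + t * Complex.I + 1)) := by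
    refine continuous_const.div (by fun_prop) fun t => mul_ne_zero ?_ ?_ <;> intro h <;>
      · have := congrArg Complex.re h
        simp at this
        linarith
  refine ((integrable_one_add_abs_rpow (r := -2) (by norm_num)).const_mul 9).mono'
    hcont.aestronglyMeasurable (Eventually.of_forall fun t => ?_)
  simpa using Complex.norm_mul_add_one_inv_le (s := σ + t * Complex.I) (by simpa using hσ)

/-- Mellin inversion for the Fejér-type weight `max 0 (1 - u)`. -/
theorem integral_cpow_mul_add_one_inv {u : ℝ} (hu : 0 < u) :
    ∫ t : ℝ, (u : ℂ) ^ (-((2 : ℂ) + t * Complex.I)) *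
      (1 / (((2 : ℂ) + t * Complex.I) * (2 + t * Complex.I + 1))) =
        2 * Real.pi * ((max 0 (1 - u) : ℝ) : ℂ) := by
  set f : ℝ → ℂ := fun t => indicator (Ioc 0 1) (fun _ => 1 : ℝ → ℂ) t -
    indicator (Ioc 0 1) (fun t => ↑t ^ (1 : ℂ) : ℝ → ℂ) t with hf
  have hmellin (s : ℂ) (hs : 0 < s.re) : HasMellin f s (1 / (s * (s + 1))) := by
    have h1 := hasMellin_one_Ioc hs
    have h2 := hasMellin_cpow_Ioc 1 (s := s) (by simp; linarith)
    have := hasMellin_sub h1.1 h2.1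
    rw [h1.2, h2.2] at this
    have h3 : s ≠ 0 := by rintro rfl; simp at hs
    have h4 : s + 1 ≠ 0 := by
      intro h
      have := congrArg Complex.re h
      simp at this
      linarith
    rwa [div_sub_div _ _ h3 h4, one_mul, mul_one, add_sub_cancel_left] at this
  have feq : ∀ t : ℝ, 0 < t → f t = ((max 0 (1 - t) : ℝ) : ℂ) := by
    intro t ht
    simp only [hf]
    by_cases h : t ≤ 1
    · rw [indicator_of_mem (by exact ⟨ht, h⟩), indicator_of_mem (by exact ⟨ht, h⟩),
        max_eq_right (by linarith)]
      simp
    · rw [indicator_of_notMem (fun h' => h h'.2), indicator_of_notMem (fun h' => h h'.2),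
        max_eq_left (by linarith)]
      simp
  have hcont : ContinuousAt f u := by
    have : ContinuousAt (fun t : ℝ => ((max 0 (1 - t) : ℝ) : ℂ)) u := by fun_prop
    refine this.congr ?_
    filter_upwards [Ioi_mem_nhds hu] with t ht using (feq t ht).symm
  have hvert (t : ℝ) : mellin f ((2 : ℝ) + t * Complex.I) =
      1 / (((2 : ℂ) + t * Complex.I) * (2 + t * Complex.I + 1)) := by
    rw [(hmellin _ (by simp)).2]
    simp
  have key := mellinInv_mellin_eq 2 f hu (hmellin _ (by simp)).1
    (by
      unfold Complex.VerticalIntegrable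
      simp only [hvert]
      simpa using integrable_mul_add_one_inv (σ := 2) (by norm_num)) hcont
  rw [feq u hu, mellinInv] at key
  simp only [hvert] at key
  rw [← key, Complex.real_smul]
  have : (Real.pi : ℂ) ≠ 0 := by exact_mod_cast Real.pi_ne_zero
  have h2π : 2 * (Real.pi : ℂ) * ((1 / (2 * Real.pi) : ℝ) : ℂ) = 1 := by
    push_cast
    field_simp
  rw [← mul_assoc, h2π, one_mul]
  simp only [smul_eq_mul, Complex.ofReal_ofNat]

/-- The smoothed Perron formula for the Riesz mean of order one. -/
theorem LSeries.integral_mul_cpow_eq {f : ℕ → ℂ} (hf : LSeriesSummable f 2) {Y : ℝ} (hY : 0 < Y) :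
    Integrable (fun t : ℝ => LSeries f (2 + t * Complex.I) *
      ((Y : ℂ) ^ ((2 : ℂ) + t * Complex.I + 1) *
        (1 / (((2 : ℂ) + t * Complex.I) * (2 + t * Complex.I + 1))))) ∧
    ∫ t : ℝ, LSeries f (2 + t * Complex.I) *
      ((Y : ℂ) ^ ((2 : ℂ) + t * Complex.I + 1) *
        (1 / (((2 : ℂ) + t * Complex.I) * (2 + t * Complex.I + 1)))) =
      2 * Real.pi * ∑ n ∈ Finset.Icc 1 ⌊Y⌋₊, f n * (Y - n) := by
  set K : ℝ → ℂ := fun t => 1 / (((2 : ℂ) + t * Complex.I) * (2 + t * Complex.I + 1)) with hK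
  have hYc : (Y : ℂ) ≠ 0 := by exact_mod_cast hY.ne'
  have hKint : Integrable K := by
    simpa [hK] using integrable_mul_add_one_inv (σ := 2) (by norm_num)
  have hYcont : Continuous fun t : ℝ => (Y : ℂ) ^ ((2 : ℂ) + t * Complex.I + 1) :=
    Continuous.const_cpow (by fun_prop) (Or.inl hYc)
  have hYnorm (t : ℝ) : ‖(Y : ℂ) ^ ((2 : ℂ) + t * Complex.I + 1)‖ = Y ^ (3 : ℝ) := by
    rw [Complex.norm_cpow_eq_rpow_re_of_pos hY]
    norm_num
  have hterm_norm (n : ℕ) (t : ℝ) :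
      ‖LSeries.term f (2 + t * Complex.I) n‖ = ‖LSeries.term f 2 n‖ := by
    rw [LSeries.norm_term_eq, LSeries.norm_term_eq]
    simp
  have hterm_cont (n : ℕ) : Continuous fun t : ℝ => LSeries.term f (2 + t * Complex.I) n := by
    rcases eq_or_ne n 0 with rfl | hn
    · simp [continuous_const]
    · simp only [LSeries.term_of_ne_zero hn]
      have hn' : (n : ℂ) ≠ 0 := by exact_mod_cast hn
      refine continuous_const.div (Continuous.const_cpow (by fun_prop) (Or.inl hn')) fun t => ?_
      simp [Complex.cpow_eq_zero_iff, hn']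
  set F : ℕ → ℝ → ℂ := fun n t => LSeries.term f (2 + t * Complex.I) n *
    ((Y : ℂ) ^ ((2 : ℂ) + t * Complex.I + 1) * K t) with hF
  have hFnorm (n : ℕ) (t : ℝ) : ‖F n t‖ = ‖LSeries.term f 2 n‖ * (Y ^ (3 : ℝ) * ‖K t‖) := by
    simp only [hF, norm_mul, hterm_norm, hYnorm]
  have hFint (n : ℕ) : Integrable (F n) := by
    refine (hKint.norm.const_mul (Y ^ (3 : ℝ))).const_mul ‖LSeries.term f 2 n‖ |>.mono'
      ?_ (Eventually.of_forall fun t => (hFnorm n t).le)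
    exact (hterm_cont n).aestronglyMeasurable.mul
      (hYcont.aestronglyMeasurable.mul hKint.aestronglyMeasurable)
  have hsum : Summable fun n => ∫ t, ‖F n t‖ := by
    simp only [hFnorm, integral_const_mul]
    exact hf.norm.mul_right _
  have htsum (t : ℝ) : ∑' n, F n t = LSeries f (2 + t * Complex.I) *
      ((Y : ℂ) ^ ((2 : ℂ) + t * Complex.I + 1) * K t) := by
    simp only [hF, LSeries, tsum_mul_right]
  have hval (n : ℕ) : ∫ t, F n t =
      if n = 0 then 0 else f n * (2 * Real.pi * (Y * (max 0 (1 - n / Y) : ℝ))) := by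
    rcases eq_or_ne n 0 with rfl | hn
    · simp [hF]
    rw [if_neg hn]
    have hn0 : (0 : ℝ) < n := by exact_mod_cast Nat.pos_of_ne_zero hn
    have hn' : (n : ℂ) ≠ 0 := by exact_mod_cast hn
    have := integral_cpow_mul_add_one_inv (u := n / Y) (by positivity)
    rw [← mul_left_comm (Y : ℂ), ← this, ← mul_assoc, ← integral_const_mul]
    congr 1
    ext t
    simp only [hF, hK, LSeries.term_of_ne_zero hn]
    have h1 : ((n / Y : ℝ) : ℂ) ^ (-((2 : ℂ) + t * Complex.I)) =
        (Y : ℂ) ^ ((2 : ℂ) + t * Complex.I) / (n : ℂ) ^ ((2 : ℂ) + t * Complex.I) := by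
      rw [Complex.cpow_neg, Complex.ofReal_div, Complex.div_cpow_ofReal_nonneg hn0.le hY.le,
        inv_div, Complex.ofReal_natCast]
    rw [h1, Complex.cpow_add _ _ hYc, Complex.cpow_one]
    ring
  have hmain := hasSum_integral_of_summable_integral_norm hFint hsum
  simp only [htsum, hval] at hmain
  have hfin : ∀ n ∉ Finset.Icc 1 ⌊Y⌋₊,
      (if n = 0 then 0 else f n * (2 * Real.pi * (Y * (max 0 (1 - n / Y) : ℝ))) : ℂ) = 0 := by
    intro n hn
    rcases eq_or_ne n 0 with rfl | hn0
    · simp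
    rw [if_neg hn0, max_eq_left]
    · simp
    · have : Y < n := by
        rw [Finset.mem_Icc, not_and] at hn
        exact Nat.lt_of_floor_lt (not_le.mp (hn (Nat.one_le_iff_ne_zero.mpr hn0)))
      rw [sub_nonpos, one_le_div hY]
      exact this.le
  refine ⟨?_, ?_⟩
  · have hLcont : Continuous fun t : ℝ => LSeries f (2 + t * Complex.I) :=
      continuous_tsum hterm_cont hf.norm fun n t => (hterm_norm n t).le
    refine (hKint.norm.const_mul (Y ^ (3 : ℝ))).const_mul (∑' n, ‖LSeries.term f 2 n‖) |>.mono'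
      (hLcont.aestronglyMeasurable.mul
        (hYcont.aestronglyMeasurable.mul hKint.aestronglyMeasurable))
      (Eventually.of_forall fun t => ?_)
    simp only [norm_mul, hYnorm]
    gcongr
    exact tsum_of_norm_bounded hf.norm.hasSum fun n => (hterm_norm n t).le
  · rw [hmain.unique (hasSum_sum_of_ne_finset_zero hfin), Finset.mul_sum]
    refine Finset.sum_congr rfl fun n hn => ?_
    rw [Finset.mem_Icc] at hn
    have hnY : (n : ℝ) ≤ Y := (Nat.le_floor_iff hY.le).mp hn.2
    rw [if_neg (by omega), max_eq_right (by rw [sub_nonneg, div_le_one hY]; exact hnY)]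
    push_cast
    field_simp

/-- Integrals over vertical lines agree when the integrand is holomorphic on the strip between them
and decays fast enough there. -/
theorem Complex.integral_vertical_line_eq {G : ℂ → ℂ} {a b K r : ℝ} (hab : a ≤ b) (hr : r < -1)
    (hG : DifferentiableOn ℂ G {z | z.re ∈ Icc a b})
    (hK : ∀ z : ℂ, z.re ∈ Icc a b → ‖G z‖ ≤ K * (1 + |z.im|) ^ r) :
    ∫ t : ℝ, G (a + t * I) = ∫ t : ℝ, G (b + t * I) := by
  have hG_int (c : ℝ) (hc : c ∈ Icc a b) : Integrable fun t : ℝ => G (c + t * I) := by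
    have hcont : Continuous fun t : ℝ => G (c + t * I) :=
      hG.continuousOn.comp_continuous (by fun_prop) fun t => by simpa using hc
    refine ((integrable_one_add_abs_rpow hr).const_mul K).mono' hcont.aestronglyMeasurable
      (Eventually.of_forall fun t => ?_)
    simpa using hK (c + t * I) (by simpa using hc)
  have hvert (c : ℝ) (hc : c ∈ Icc a b) :
      Tendsto (fun T : ℝ => ∫ t in (-T)..T, G (c + t * I)) atTop (𝓝 (∫ t : ℝ, G (c + t * I))) :=
    intervalIntegral_tendsto_integral (hG_int c hc) tendsto_neg_atTop_atBot tendsto_id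
  have hdecay : Tendsto (fun T : ℝ => K * (1 + |T|) ^ r * |b - a|) atTop (𝓝 0) := by
    have h1 : Tendsto (fun T : ℝ => 1 + |T|) atTop atTop :=
      tendsto_atTop_add_const_left _ _ tendsto_abs_atTop_atTop
    have h2 := (tendsto_rpow_neg_atTop (y := -r) (by linarith)).comp h1
    simpa [Function.comp_def] using (h2.const_mul K).mul_const |b - a|
  have hhor (e : ℝ) (he : |e| = 1) :
      Tendsto (fun T : ℝ => ∫ x in a..b, G (x + (e * T : ℝ) * I)) atTop (𝓝 0) := by
    refine squeeze_zero_norm (fun T => ?_) hdecay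
    refine intervalIntegral.norm_integral_le_of_norm_le_const fun x hx => ?_
    rw [uIoc_of_le hab] at hx
    have := hK (x + (e * T : ℝ) * I) (by simpa using ⟨hx.1.le, hx.2⟩)
    simpa [abs_mul, he] using this
  have hrect (T : ℝ) : (∫ x in a..b, G (x + ((-1) * T : ℝ) * I)) -
      (∫ x in a..b, G (x + (1 * T : ℝ) * I)) +
      I * (∫ t in (-T)..T, G (b + t * I)) - I * (∫ t in (-T)..T, G (a + t * I)) = 0 := by
    have := Complex.integral_boundary_rect_eq_zero_of_differentiableOn G ⟨a, -T⟩ ⟨b, T⟩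
      (hG.mono fun z hz => by simpa [uIcc_of_le hab] using hz.1)
    simpa using this
  have hlim := (((hhor (-1) (by simp)).sub (hhor 1 (by simp))).add
    ((hvert b ⟨hab, le_rfl⟩).const_mul I)).sub ((hvert a ⟨le_rfl, hab⟩).const_mul I)
  simp only [hrect] at hlim
  have h0 := tendsto_nhds_unique hlim tendsto_const_nhds
  have h1 : I * ((∫ t : ℝ, G (b + t * I)) - ∫ t : ℝ, G (a + t * I)) = 0 := by
    linear_combination h0
  rcases mul_eq_zero.mp h1 with h | h
  · exact absurd h I_ne_zero
  · exact (sub_eq_zero.mp h).symm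

theorem Real.le_mul_rpow_mul_rpow_of_le {u A P Q θ : ℝ} (hu : 0 ≤ u) (hA : 0 ≤ A) (hP : 0 ≤ P)
    (hQ : 0 ≤ Q) (hθ : 0 ≤ θ) (hθ' : θ ≤ 1) (h₁ : u ≤ A * P) (h₂ : u ≤ A * Q) :
    u ≤ A * (P ^ θ * Q ^ (1 - θ)) := by
  have key (v : ℝ) (hv : 0 ≤ v) : v ^ θ * v ^ (1 - θ) = v := by
    rw [← Real.rpow_add_of_nonneg hv hθ (by linarith), add_sub_cancel, Real.rpow_one]
  calc u = u ^ θ * u ^ (1 - θ) := (key u hu).symm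
    _ ≤ (A * P) ^ θ * (A * Q) ^ (1 - θ) := by
        gcongr
    _ = (A ^ θ * A ^ (1 - θ)) * (P ^ θ * Q ^ (1 - θ)) := by
        rw [Real.mul_rpow hA hP, Real.mul_rpow hA hQ]
        ring
    _ = _ := by rw [key A hA]

theorem Complex.norm_cpow_sub_cpow_le {x y : ℝ} (hx : 0 < x) (hxy : x ≤ y) {s : ℂ}
    (hs : 1 ≤ s.re) : ‖(y : ℂ) ^ s - (x : ℂ) ^ s‖ ≤ ‖s‖ * y ^ (s.re - 1) * (y - x) := by
  have hderiv (t : ℝ) (ht : t ∈ Icc x y) :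
      HasDerivWithinAt (fun t : ℝ => (t : ℂ) ^ s) (s * (t : ℂ) ^ (s - 1)) (Icc x y) t := by
    have ht0 : 0 < t := hx.trans_le ht.1
    have := (hasStrictDerivAt_cpow_const (x := (t : ℂ)) (c := s)
      (by simp [ht0])).hasDerivAt
    exact this.comp_ofReal.hasDerivWithinAt
  have := Convex.norm_image_sub_le_of_norm_hasDerivWithin_le (C := ‖s‖ * y ^ (s.re - 1)) hderiv
    (fun t ht => by
      have ht0 : 0 < t := hx.trans_le ht.1
      rw [norm_mul, Complex.norm_cpow_eq_rpow_re_of_pos ht0]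
      simp only [sub_re, one_re]
      have := ht.2
      gcongr) (convex_Icc x y) (left_mem_Icc.mpr hxy) (right_mem_Icc.mpr hxy)
  rwa [Real.norm_of_nonneg (by linarith)] at this

theorem Complex.norm_smoothing_kernel_le {y : ℝ} (hy : 1 ≤ y) {s : ℂ} (hs : s.re = 3 / 5) :
    ‖((((y + √y : ℝ) : ℂ) ^ (s + 1)) - (y : ℂ) ^ (s + 1)) * (1 / (s * (s + 1)))‖ ≤
      72 * √y * y ^ (5 / 8 : ℝ) * (1 + |s.im|) ^ (-(21 / 20) : ℝ) := by
  have hy0 : 0 < y := by linarith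
  have hsq : √y ≤ y := Real.sqrt_le_iff.mpr ⟨hy0.le, by nlinarith⟩
  have hsq0 : 0 < √y := Real.sqrt_pos.mpr hy0
  have hle : y + √y ≤ 2 * y := by linarith
  have hτ : 0 < 1 + |s.im| := by positivity
  set τ := 1 + |s.im| with hτ_def
  have hre : (s + 1).re = 8 / 5 := by simp [hs]; norm_num
  have hpow (c : ℝ) (hc : 0 ≤ c) (hc2 : c ≤ 2) : (y + √y) ^ c ≤ 4 * y ^ c := by
    calc (y + √y) ^ c ≤ (2 * y) ^ c := by gcongr
      _ = 2 ^ c * y ^ c := Real.mul_rpow (by norm_num) hy0.le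
      _ ≤ 2 ^ (2 : ℝ) * y ^ c := by
        gcongr
        norm_num
      _ = 4 * y ^ c := by norm_num
  have hsqrt : √y * √y = y := Real.mul_self_sqrt hy0.le
  have hsplit : y ^ (8 / 5 : ℝ) = √y * y ^ (3 / 5 : ℝ) * √y := by
    rw [show (8 / 5 : ℝ) = 1 + 3 / 5 by norm_num, Real.rpow_add hy0, Real.rpow_one]
    linear_combination -(y ^ (3 / 5 : ℝ)) * hsqrt
  have h₁ : ‖((((y + √y : ℝ) : ℂ) ^ (s + 1)) - (y : ℂ) ^ (s + 1)) * (1 / (s * (s + 1)))‖ ≤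
      72 * √y * y ^ (3 / 5 : ℝ) * (√y * τ ^ (-2 : ℝ)) := by
    have hn := norm_mul_add_one_inv_le hs.ge
    have hd : ‖(((y + √y : ℝ) : ℂ) ^ (s + 1)) - (y : ℂ) ^ (s + 1)‖ ≤ 8 * y ^ (8 / 5 : ℝ) := by
      refine (norm_sub_le _ _).trans ?_
      rw [norm_cpow_eq_rpow_re_of_pos (by positivity), norm_cpow_eq_rpow_re_of_pos hy0, hre]
      have := hpow (8 / 5) (by norm_num) (by norm_num)
      have := Real.rpow_pos_of_pos hy0 (8 / 5)
      linarith
    rw [norm_mul]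
    calc _ ≤ 8 * y ^ (8 / 5 : ℝ) * (9 * τ ^ (-2 : ℝ)) := by gcongr
      _ = _ := by rw [hsplit]; ring
  have h₂ : ‖((((y + √y : ℝ) : ℂ) ^ (s + 1)) - (y : ℂ) ^ (s + 1)) * (1 / (s * (s + 1)))‖ ≤
      72 * √y * y ^ (3 / 5 : ℝ) * τ ^ (-1 : ℝ) := by
    have hd := norm_cpow_sub_cpow_le hy0 (show y ≤ y + √y by linarith) (s := s + 1)
      (by rw [hre]; norm_num)
    rw [hre, add_sub_cancel_left] at hd
    have hp := hpow (3 / 5) (by norm_num) (by norm_num)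
    rw [show (8 / 5 - 1 : ℝ) = 3 / 5 by norm_num] at hd
    have hs1 : 0 < ‖s + 1‖ := by
      refine norm_pos_iff.mpr fun h => ?_
      rw [h] at hre
      norm_num at hre
    have hs0 := one_add_abs_im_le_three_mul_norm hs.ge
    rw [← hτ_def] at hs0
    have hspos : 0 < ‖s‖ := by linarith
    rw [norm_mul, norm_div, norm_one, norm_mul, Real.rpow_neg_one]
    calc _ ≤ ‖s + 1‖ * (4 * y ^ (3 / 5 : ℝ)) * √y * (1 / (‖s‖ * ‖s + 1‖)) := by
          refine mul_le_mul_of_nonneg_right (hd.trans ?_) (by positivity)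
          gcongr
      _ = 4 * √y * y ^ (3 / 5 : ℝ) * ‖s‖⁻¹ := by field_simp
      _ ≤ 4 * √y * y ^ (3 / 5 : ℝ) * (3 * τ⁻¹) := by
          gcongr
          rw [inv_le_comm₀ hspos (by positivity), mul_inv, inv_inv]
          linarith
      _ ≤ _ := by
          have : 0 ≤ √y * y ^ (3 / 5 : ℝ) * τ⁻¹ := by positivity
          linarith
  refine (Real.le_mul_rpow_mul_rpow_of_le (θ := 1 / 20) (norm_nonneg _) (by positivity)
    (by positivity) (by positivity) (by norm_num) (by norm_num) h₁ h₂).trans_eq ?_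
  rw [Real.mul_rpow hsq0.le (by positivity), ← Real.rpow_mul hτ.le, ← Real.rpow_mul hτ.le,
    mul_assoc ((√y) ^ (1 / 20 : ℝ)), ← Real.rpow_add hτ, Real.sqrt_eq_rpow, ← Real.rpow_mul hy0.le,
    show (5 / 8 : ℝ) = 3 / 5 + 1 / 2 * (1 / 20) by norm_num, Real.rpow_add hy0]
  norm_num
  ring

/-- If the Dirichlet series of `f` continues holomorphically to the strip `3/5 ≤ Re s ≤ 2` with at
most slow polynomial growth, then increments of its first Riesz mean save a power. -/
theorem LSeries.norm_rieszMean_increment_le {f : ℕ → ℂ} (hf : LSeriesSummable f 2) {F : ℂ → ℂ}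
    {A : ℝ} (hA : 0 ≤ A) (hF : DifferentiableOn ℂ F {s | s.re ∈ Icc (3 / 5) 2})
    (hFA : ∀ s : ℂ, s.re ∈ Icc (3 / 5) 2 → ‖F s‖ ≤ A * (1 + |s.im|) ^ (1 / 40 : ℝ))
    (hFf : ∀ t : ℝ, LSeries f (2 + t * Complex.I) = F (2 + t * Complex.I)) {y : ℝ} (hy : 1 ≤ y) :
    ‖∑ n ∈ Finset.Icc 1 ⌊y + √y⌋₊, f n * ((y + √y : ℝ) - n) -
        ∑ n ∈ Finset.Icc 1 ⌊y⌋₊, f n * (y - n)‖ ≤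
      72 * A * (∫ t : ℝ, (1 + |t|) ^ (-(41 / 40) : ℝ)) * √y * y ^ (5 / 8 : ℝ) := by
  have hy0 : 0 < y := by linarith
  set Y := y + √y with hY
  have hY0 : 0 < Y := by positivity
  have hyY : y ≤ Y := by linarith [Real.sqrt_nonneg y]
  set G : ℂ → ℂ := fun s => F s * ((((Y : ℂ) ^ (s + 1)) - (y : ℂ) ^ (s + 1)) *
    (1 / (s * (s + 1)))) with hG
  have hGdiff : DifferentiableOn ℂ G {s | s.re ∈ Icc (3 / 5) 2} := by
    refine hF.mul (DifferentiableOn.mul ?_ ?_)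
    · have (x : ℝ) (hx : 0 < x) : Differentiable ℂ fun s : ℂ => (x : ℂ) ^ (s + 1) := fun s =>
        (differentiableAt_id.add_const (1 : ℂ)).const_cpow
          (Or.inl (Complex.ofReal_ne_zero.mpr hx.ne'))
      exact ((this Y hY0).sub (this y hy0)).differentiableOn
    · refine (differentiableOn_const _).div (by fun_prop) fun s hs => mul_ne_zero ?_ ?_ <;>
        intro h <;>
        · have h1 := congrArg Complex.re h
          have h2 := hs.1
          simp at h1
          linarith
  have hGbound (z : ℂ) (hz : z.re ∈ Icc (3 / 5) 2) :
      ‖G z‖ ≤ (A * (18 * Y ^ (3 : ℝ))) * (1 + |z.im|) ^ (-(79 / 40) : ℝ) := by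
    have hp (x : ℝ) (hx : 1 ≤ x) (hxY : x ≤ Y) : ‖(x : ℂ) ^ (z + 1)‖ ≤ Y ^ (3 : ℝ) := by
      rw [Complex.norm_cpow_eq_rpow_re_of_pos (by linarith)]
      calc x ^ (z + 1).re ≤ x ^ (3 : ℝ) := by
            refine Real.rpow_le_rpow_of_exponent_le hx ?_
            have := hz.2
            simp only [Complex.add_re, Complex.one_re]
            linarith
        _ ≤ _ := by gcongr
    have hτ : 0 < 1 + |z.im| := by positivity
    simp only [hG]
    rw [norm_mul, norm_mul]
    calc _ ≤ (A * (1 + |z.im|) ^ (1 / 40 : ℝ)) *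
          ((Y ^ (3 : ℝ) + Y ^ (3 : ℝ)) * (9 * (1 + |z.im|) ^ (-2 : ℝ))) := by
          gcongr
          · exact hFA z hz
          · exact (norm_sub_le _ _).trans
              (add_le_add (hp Y (hy.trans hyY) le_rfl) (hp y hy hyY))
          · exact Complex.norm_mul_add_one_inv_le hz.1
      _ = (A * (18 * Y ^ (3 : ℝ))) * ((1 + |z.im|) ^ (1 / 40 : ℝ) * (1 + |z.im|) ^ (-2 : ℝ)) := by
          ring
      _ = _ := by
          rw [← Real.rpow_add hτ]
          norm_num
  have hshift := Complex.integral_vertical_line_eq (a := 3 / 5) (b := 2) (by norm_num)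
    (by norm_num) hGdiff hGbound
  obtain ⟨hi1, he1⟩ := LSeries.integral_mul_cpow_eq hf hY0
  obtain ⟨hi2, he2⟩ := LSeries.integral_mul_cpow_eq hf hy0
  have hdiff : 2 * Real.pi * (∑ n ∈ Finset.Icc 1 ⌊Y⌋₊, f n * (Y - n) -
      ∑ n ∈ Finset.Icc 1 ⌊y⌋₊, f n * (y - n)) = ∫ t : ℝ, G ((3 / 5 : ℝ) + t * Complex.I) := by
    rw [mul_sub, ← he1, ← he2, ← integral_sub hi1 hi2, hshift]
    congr 1
    ext t
    simp only [hG, hFf, Complex.ofReal_ofNat]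
    ring
  have hline : ‖∫ t : ℝ, G ((3 / 5 : ℝ) + t * Complex.I)‖ ≤
      ∫ t : ℝ, (72 * A * √y * y ^ (5 / 8 : ℝ)) * (1 + |t|) ^ (-(41 / 40) : ℝ) := by
    refine norm_integral_le_of_norm_le
      ((integrable_one_add_abs_rpow (by norm_num)).const_mul _) (Eventually.of_forall fun t => ?_)
    have hre : ((3 / 5 : ℝ) + t * Complex.I : ℂ).re = 3 / 5 := by simp
    have him : ((3 / 5 : ℝ) + t * Complex.I : ℂ).im = t := by simp
    have h1 := hFA ((3 / 5 : ℝ) + t * Complex.I) (by rw [hre]; norm_num)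
    have h2 := Complex.norm_smoothing_kernel_le hy hre
    rw [him] at h1 h2
    have hτ : 0 < 1 + |t| := by positivity
    simp only [hG]
    rw [norm_mul]
    calc _ ≤ (A * (1 + |t|) ^ (1 / 40 : ℝ)) *
          (72 * √y * y ^ (5 / 8 : ℝ) * (1 + |t|) ^ (-(21 / 20) : ℝ)) := by gcongr
      _ = (72 * A * √y * y ^ (5 / 8 : ℝ)) *
          ((1 + |t|) ^ (1 / 40 : ℝ) * (1 + |t|) ^ (-(21 / 20) : ℝ)) := by ring
      _ = _ := by
          rw [← Real.rpow_add hτ]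
          norm_num
  rw [← hdiff, norm_mul, integral_const_mul] at hline
  have hpi : 1 ≤ ‖(2 * Real.pi : ℂ)‖ := by
    rw [norm_mul, Complex.norm_real, Complex.norm_ofNat, Real.norm_of_nonneg Real.pi_pos.le]
    linarith [Real.pi_gt_three]
  calc _ ≤ _ := le_mul_of_one_le_left (norm_nonneg _) hpi
    _ ≤ _ := hline
    _ = _ := by ring

theorem norm_sum_le_of_rieszMean_increment {f : ℕ → ℂ} {y B : ℝ} (hy : 1 ≤ y)
    (hf : ∀ n : ℕ, 1 ≤ n → ‖f n‖ ≤ Real.log n)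
    (hB : ‖∑ n ∈ Finset.Icc 1 ⌊y + √y⌋₊, f n * ((y + √y : ℝ) - n) -
        ∑ n ∈ Finset.Icc 1 ⌊y⌋₊, f n * (y - n)‖ ≤ √y * B) :
    ‖∑ n ∈ Finset.Icc 1 ⌊y⌋₊, f n‖ ≤ B + 32 * y ^ (5 / 8 : ℝ) := by
  have hy0 : 0 < y := by linarith
  have hsq0 : 0 < √y := Real.sqrt_pos.mpr hy0
  have hsq1 : 1 ≤ √y := Real.one_le_sqrt.mpr hy
  have hsq : √y ≤ y := Real.sqrt_le_iff.mpr ⟨hy0.le, by nlinarith⟩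
  set Y := y + √y with hY
  have hfloor : ⌊y⌋₊ ≤ ⌊Y⌋₊ := Nat.floor_mono (by linarith)
  have hsplit : ∑ n ∈ Finset.Icc 1 ⌊Y⌋₊, f n * (Y - n) =
      ∑ n ∈ Finset.Icc 1 ⌊y⌋₊, f n * (Y - n) + ∑ n ∈ Finset.Ioc ⌊y⌋₊ ⌊Y⌋₊, f n * (Y - n) := by
    have h (m : ℕ) : Finset.Icc 1 m = Finset.Ioc 0 m := rfl
    rw [h, h, ← Finset.sum_union (Finset.Ioc_disjoint_Ioc_of_le le_rfl),
      Finset.Ioc_union_Ioc_eq_Ioc (Nat.zero_le _) hfloor]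
  have hdiff : (√y : ℂ) * ∑ n ∈ Finset.Icc 1 ⌊y⌋₊, f n =
      (∑ n ∈ Finset.Icc 1 ⌊Y⌋₊, f n * (Y - n) - ∑ n ∈ Finset.Icc 1 ⌊y⌋₊, f n * (y - n)) -
        ∑ n ∈ Finset.Ioc ⌊y⌋₊ ⌊Y⌋₊, f n * (Y - n) := by
    rw [hsplit, add_sub_right_comm, add_sub_cancel_right, ← Finset.sum_sub_distrib,
      Finset.mul_sum]
    refine Finset.sum_congr rfl fun n _ => ?_
    rw [hY]
    push_cast
    ring
  have htail : ‖∑ n ∈ Finset.Ioc ⌊y⌋₊ ⌊Y⌋₊, f n * (Y - n)‖ ≤ √y * (32 * y ^ (5 / 8 : ℝ)) := by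
    have hterm : ∀ n ∈ Finset.Ioc ⌊y⌋₊ ⌊Y⌋₊, ‖f n * (Y - n)‖ ≤ Real.log (2 * y) * √y := by
      intro n hn
      rw [Finset.mem_Ioc] at hn
      have h1 : y < n := Nat.lt_of_floor_lt hn.1
      have h2 : (n : ℝ) ≤ Y := (Nat.le_floor_iff (by positivity)).mp hn.2
      have h3 : ‖((Y : ℂ) - n)‖ ≤ √y := by
        rw [← Complex.ofReal_natCast, ← Complex.ofReal_sub, Complex.norm_real,
          Real.norm_of_nonneg (by linarith)]
        linarith
      rw [norm_mul]
      refine mul_le_mul ((hf n (by omega)).trans ?_) h3 (norm_nonneg _)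
        (Real.log_nonneg (by linarith))
      exact Real.log_le_log (by linarith) (by linarith)
    refine (norm_sum_le_of_le _ hterm).trans ?_
    rw [Finset.sum_const, Nat.card_Ioc, nsmul_eq_mul, Nat.cast_sub hfloor]
    have h4 : (⌊Y⌋₊ : ℝ) - ⌊y⌋₊ ≤ 2 * √y := by
      have := Nat.floor_le (show 0 ≤ Y by positivity)
      have := Nat.lt_floor_add_one y
      linarith
    have h5 : Real.log (2 * y) ≤ 16 * y ^ (1 / 8 : ℝ) := by
      refine (Real.log_le_rpow_div (by positivity) (show (0 : ℝ) < 1 / 8 by norm_num)).trans ?_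
      rw [Real.mul_rpow (by norm_num) hy0.le]
      have h6 : (2 : ℝ) ^ (1 / 8 : ℝ) ≤ 2 := by
        calc (2 : ℝ) ^ (1 / 8 : ℝ) ≤ 2 ^ (1 : ℝ) :=
              Real.rpow_le_rpow_of_exponent_le (by norm_num) (by norm_num)
          _ = 2 := Real.rpow_one 2
      have h7 : 0 ≤ y ^ (1 / 8 : ℝ) := by positivity
      nlinarith
    have h8 : y ^ (5 / 8 : ℝ) = √y * y ^ (1 / 8 : ℝ) := by
      rw [Real.sqrt_eq_rpow, ← Real.rpow_add hy0]
      norm_num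
    calc _ ≤ 2 * √y * (16 * y ^ (1 / 8 : ℝ) * √y) := by
          have : 0 ≤ Real.log (2 * y) := Real.log_nonneg (by linarith)
          gcongr
      _ = _ := by rw [h8]; ring
  have hfin : √y * ‖∑ n ∈ Finset.Icc 1 ⌊y⌋₊, f n‖ ≤ √y * (B + 32 * y ^ (5 / 8 : ℝ)) := by
    calc √y * ‖∑ n ∈ Finset.Icc 1 ⌊y⌋₊, f n‖ = ‖(√y : ℂ) * ∑ n ∈ Finset.Icc 1 ⌊y⌋₊, f n‖ := by
          rw [norm_mul, Complex.norm_real, Real.norm_of_nonneg hsq0.le]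
      _ ≤ _ := by
          rw [hdiff]
          refine (norm_sub_le _ _).trans ((add_le_add hB htail).trans_eq ?_)
          ring
  exact le_of_mul_le_mul_left hfin hsq0

theorem DirichletCharacter.exists_norm_sum_mul_vonMangoldt_le :
    ∃ C : ℝ, 0 < C ∧ ∀ (N : ℕ) [NeZero N], 3 ≤ N → ∀ ψ : DirichletCharacter ℂ N, ψ ≠ 1 →
      (∀ s : ℂ, 1 / 2 < s.re → ψ.LFunction s ≠ 0) → ∀ y : ℝ, 1 ≤ y →
      ‖∑ n ∈ Finset.Icc 1 ⌊y⌋₊, ψ (n : ZMod N) * (ArithmeticFunction.vonMangoldt n : ℂ)‖ ≤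
        C * Real.log N * y ^ (5 / 8 : ℝ) := by
  obtain ⟨A, hA, hbound⟩ := exists_norm_logDeriv_LFunction_le
  set J := ∫ t : ℝ, (1 + |t|) ^ (-(41 / 40) : ℝ) with hJ
  have hJ0 : 0 ≤ J := integral_nonneg fun t => by positivity
  refine ⟨72 * A * J + 32, by positivity, fun N _ hN ψ hψ hψ0 y hy => ?_⟩
  have hlogN : 1 ≤ Real.log N := by
    have hN' : (3 : ℝ) ≤ N := by exact_mod_cast hN
    rw [Real.le_log_iff_exp_le (by linarith)]
    linarith [Real.exp_one_lt_d9]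
  set f : ℕ → ℂ := (fun n : ℕ => ψ (n : ZMod N)) *
    fun n : ℕ => (ArithmeticFunction.vonMangoldt n : ℂ) with hf
  have hfsum (s : ℂ) (hs : 1 < s.re) : LSeriesSummable f s :=
    LSeriesSummable_twist_vonMangoldt ψ hs
  have hL := differentiable_LFunction hψ
  have key := LSeries.norm_rieszMean_increment_le (hfsum 2 (by simp)) (A := A * Real.log N)
    (F := fun s => -(deriv ψ.LFunction s / ψ.LFunction s)) (by positivity) ?_ ?_ ?_ hy
  · have := norm_sum_le_of_rieszMean_increment (f := f) (y := y)
      (B := 72 * (A * Real.log N) * J * y ^ (5 / 8 : ℝ)) hy ?_ (key.trans_eq (by ring))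
    · refine this.trans ?_
      have h5 : 0 ≤ y ^ (5 / 8 : ℝ) := by positivity
      nlinarith
    · intro n hn
      simp only [hf, Pi.mul_apply, norm_mul, Complex.norm_real]
      rw [Real.norm_of_nonneg ArithmeticFunction.vonMangoldt_nonneg]
      exact (mul_le_of_le_one_left ArithmeticFunction.vonMangoldt_nonneg (ψ.norm_le_one _)).trans
        ArithmeticFunction.vonMangoldt_le_log
  · intro s hs
    have h0 : ψ.LFunction s ≠ 0 := hψ0 s (by linarith [hs.1])
    exact ((hL.contDiff.differentiable_deriv_two s).div (hL s) h0).neg.differentiableWithinAt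
  · intro s hs
    rw [norm_neg]
    exact hbound N hN ψ hψ hψ0 s hs.1 hs.2
  · intro t
    have hs : 1 < ((2 : ℂ) + t * Complex.I).re := by simp
    rw [hf, LSeries_twist_vonMangoldt_eq ψ hs, LFunction_eq_LSeries ψ hs,
      deriv_LFunction_eq_deriv_LSeries ψ hs, neg_div]

/-- The contribution of proper prime powers to a von Mangoldt sum with bounded weights. -/
lemma norm_sum_mul_vonMangoldt_sub_sum_prime_le (a : ℕ → ℂ) (ha : ∀ n, ‖a n‖ ≤ 1) (y : ℝ) :
    ‖∑ n ∈ Finset.Icc 1 ⌊y⌋₊, a n * (ArithmeticFunction.vonMangoldt n : ℂ) -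
      ∑ n ∈ Finset.Icc 1 ⌊y⌋₊, (if n.Prime then a n * (Real.log n : ℂ) else 0)‖ ≤
      Chebyshev.psi y - Chebyshev.theta y := by
  have hset : Finset.Ioc 0 ⌊y⌋₊ = Finset.Icc 1 ⌊y⌋₊ := by ext n; simp; omega
  rw [Chebyshev.psi, Chebyshev.theta, Finset.sum_filter, hset, ← Finset.sum_sub_distrib,
    ← Finset.sum_sub_distrib]
  refine norm_sum_le_of_le _ fun n _ => ?_
  split_ifs with hp
  · simp [ArithmeticFunction.vonMangoldt_apply_prime hp]
  · rw [sub_zero, sub_zero, norm_mul, Complex.norm_real, Real.norm_eq_abs,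
      abs_of_nonneg ArithmeticFunction.vonMangoldt_nonneg]
    exact mul_le_of_le_one_left ArithmeticFunction.vonMangoldt_nonneg (ha n)

/-- Abel's inequality for a nonincreasing nonnegative weight. -/
lemma norm_sum_range_mul_le_of_antitone {g : ℕ → ℝ} (hg : Antitone g) (hg0 : ∀ i, 0 ≤ g i)
    (a : ℕ → ℂ) {B : ℝ} (n : ℕ) (hB : ∀ k ≤ n, ‖∑ i ∈ Finset.range k, a i‖ ≤ B) :
    ‖∑ i ∈ Finset.range n, (g i : ℂ) * a i‖ ≤ g 0 * B := by
  have hB0 : 0 ≤ B := by simpa using hB 0 (Nat.zero_le _)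
  have hparts := Finset.sum_range_by_parts (fun i => (g i : ℂ)) a n
  simp only [smul_eq_mul] at hparts
  rw [hparts]
  calc _ ≤ g (n - 1) * B + ∑ i ∈ Finset.range (n - 1), (g i - g (i + 1)) * B := by
        refine (norm_sub_le _ _).trans (add_le_add ?_ (norm_sum_le_of_le _ fun i hi => ?_))
        · rw [norm_mul, Complex.norm_real, Real.norm_eq_abs, abs_of_nonneg (hg0 _)]
          exact mul_le_mul_of_nonneg_left (hB n le_rfl) (hg0 _)
        · rw [Finset.mem_range] at hi
          rw [norm_mul, ← Complex.ofReal_sub, Complex.norm_real, Real.norm_eq_abs,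
            abs_sub_comm, abs_of_nonneg (sub_nonneg.2 (hg (Nat.le_succ i)))]
          exact mul_le_mul_of_nonneg_left (hB _ (by omega)) (sub_nonneg.2 (hg (Nat.le_succ i)))
    _ = g 0 * B := by
        rw [← Finset.sum_mul, Finset.sum_range_sub']
        ring

/-- Under GRH for `ψ`, sums of `ψ` over primes show square-root-type cancellation. -/
theorem DirichletCharacter.exists_norm_sum_prime_le :
    ∃ C : ℝ, 0 < C ∧ ∀ (N : ℕ) [NeZero N], 3 ≤ N → ∀ ψ : DirichletCharacter ℂ N, ψ ≠ 1 →
      (∀ s : ℂ, 1 / 2 < s.re → ψ.LFunction s ≠ 0) → ∀ y : ℝ, 1 ≤ y →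
      ‖∑ q ∈ (Finset.Icc 1 ⌊y⌋₊).filter Nat.Prime, ψ (q : ZMod N)‖ ≤
        C * Real.log N * y ^ (5 / 8 : ℝ) := by
  obtain ⟨C, hC, h⟩ := DirichletCharacter.exists_norm_sum_mul_vonMangoldt_le
  obtain ⟨D, hD⟩ := Chebyshev.psi_sub_theta_le_mul_sqrt
  refine ⟨(C + |D|) * (Real.log 2)⁻¹, by positivity, fun N _ hN ψ hψ hz y hy => ?_⟩
  have hlogN : 1 ≤ Real.log N := by
    rw [Real.le_log_iff_exp_le (by positivity)]
    have : (3 : ℝ) ≤ N := by exact_mod_cast hN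
    linarith [Real.exp_one_lt_d9]
  set a : ℕ → ℂ := fun n => if n.Prime then ψ n * (Real.log n : ℂ) else 0 with ha
  have hrange : ∀ (f : ℕ → ℂ) (n : ℕ), f 0 = 0 →
      ∑ i ∈ Finset.range (n + 1), f i = ∑ i ∈ Finset.Icc 1 n, f i := by
    intro f n h0
    rw [Finset.sum_range_eq_add_Ico _ (by omega), h0, zero_add]
    rfl
  have hmain : ∀ k : ℕ, 1 ≤ k → (k : ℝ) ≤ y → ‖∑ i ∈ Finset.Icc 1 k, a i‖ ≤
      (C + |D|) * Real.log N * y ^ (5 / 8 : ℝ) := by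
    intro k hk hky
    have hk1 : (1 : ℝ) ≤ k := by exact_mod_cast hk
    have h1 := h N hN ψ hψ hz k hk1
    have h2 := norm_sum_mul_vonMangoldt_sub_sum_prime_le (fun n => ψ (n : ZMod N))
      (fun n => ψ.norm_le_one _) k
    have h3 := hD k
    simp only [Nat.floor_natCast] at h1 h2
    have h4 : √(k : ℝ) ≤ (k : ℝ) ^ (5 / 8 : ℝ) := by
      rw [Real.sqrt_eq_rpow]
      exact Real.rpow_le_rpow_of_exponent_le hk1 (by norm_num)
    have h5 : (k : ℝ) ^ (5 / 8 : ℝ) ≤ y ^ (5 / 8 : ℝ) := by gcongr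
    have h6 := norm_sub_norm_le (∑ i ∈ Finset.Icc 1 k, a i)
      (∑ n ∈ Finset.Icc 1 k, ψ (n : ZMod N) * (ArithmeticFunction.vonMangoldt n : ℂ))
    rw [norm_sub_rev] at h6
    have h7 : D * √(k : ℝ) ≤ |D| * Real.log N * (k : ℝ) ^ (5 / 8 : ℝ) := by
      calc D * √(k : ℝ) ≤ |D| * √(k : ℝ) := by gcongr; exact le_abs_self D
        _ ≤ |D| * (k : ℝ) ^ (5 / 8 : ℝ) := by gcongr
        _ ≤ _ := by
          gcongr
          exact le_mul_of_one_le_right (abs_nonneg D) hlogN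
    have h8 : (C + |D|) * Real.log N * (k : ℝ) ^ (5 / 8 : ℝ) ≤
        (C + |D|) * Real.log N * y ^ (5 / 8 : ℝ) := by gcongr
    linarith
  set g : ℕ → ℝ := fun i => (Real.log (max i 2 : ℕ))⁻¹ with hgdef
  have hg : Antitone g := by
    intro i j hij
    have h1 : (1 : ℝ) < (max i 2 : ℕ) := by
      exact_mod_cast (by omega : 1 < max i 2)
    have h2 : ((max i 2 : ℕ) : ℝ) ≤ (max j 2 : ℕ) := by
      exact_mod_cast max_le_max_right 2 hij
    exact inv_anti₀ (Real.log_pos h1) (Real.log_le_log (by linarith) h2)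
  have hg0 : ∀ i, 0 ≤ g i := fun i => inv_nonneg.2 (Real.log_natCast_nonneg _)
  have hB0 : 0 ≤ (C + |D|) * Real.log N * y ^ (5 / 8 : ℝ) := by positivity
  have habel := norm_sum_range_mul_le_of_antitone hg hg0 a
    (B := (C + |D|) * Real.log N * y ^ (5 / 8 : ℝ)) (⌊y⌋₊ + 1) (fun k hk => by
      rcases k with _ | k
      · simpa using hB0
      · rw [hrange a k (by simp [ha])]
        rcases k with _ | k
        · simpa using hB0
        · exact hmain _ (by omega) ((Nat.le_floor_iff (by linarith)).1 (by omega)))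
  rw [hrange _ _ (by simp [ha])] at habel
  have hsum : ∑ i ∈ Finset.Icc 1 ⌊y⌋₊, (g i : ℂ) * a i =
      ∑ q ∈ (Finset.Icc 1 ⌊y⌋₊).filter Nat.Prime, ψ (q : ZMod N) := by
    rw [Finset.sum_filter]
    refine Finset.sum_congr rfl fun i _ => ?_
    simp only [ha]
    split_ifs with hp
    · have hlog : (Real.log i : ℂ) ≠ 0 := by
        exact_mod_cast (Real.log_pos (by exact_mod_cast hp.one_lt)).ne'
      simp only [hgdef, max_eq_left hp.two_le, Complex.ofReal_inv]
      field_simp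
    · simp
  rw [hsum] at habel
  refine habel.trans (le_of_eq ?_)
  simp only [hgdef]
  norm_num
  ring

lemma sum_Icc_rpow_le {c : ℝ} (hc : 0 < c) (hc1 : c ≤ 1) (n : ℕ) :
    ∑ r ∈ Finset.Icc 1 n, (r : ℝ) ^ (c - 1) ≤ c⁻¹ * (n : ℝ) ^ c := by
  induction n with
  | zero => simp [hc.ne']
  | succ n ih =>
    rw [Finset.sum_Icc_succ_top (by omega)]
    have hn : (0 : ℝ) < (n + 1 : ℕ) := by positivity
    have hb := rpow_one_add_le_one_add_mul_self (s := -(((n + 1 : ℕ) : ℝ))⁻¹)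
      (by rw [neg_le_neg_iff]; exact inv_le_one_of_one_le₀ (by simp)) hc.le hc1
    have hsplit : (n : ℝ) = (n + 1 : ℕ) * (1 + -(((n + 1 : ℕ) : ℝ))⁻¹) := by
      field_simp; push_cast; ring
    have hpos : 0 ≤ 1 + -(((n + 1 : ℕ) : ℝ))⁻¹ := by
      rw [← sub_eq_add_neg, sub_nonneg]; exact inv_le_one_of_one_le₀ (by simp)
    have hle : (n : ℝ) ^ c ≤ ((n + 1 : ℕ) : ℝ) ^ c - c * ((n + 1 : ℕ) : ℝ) ^ (c - 1) := by
      calc (n : ℝ) ^ c = ((n + 1 : ℕ) : ℝ) ^ c * (1 + -(((n + 1 : ℕ) : ℝ))⁻¹) ^ c := by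
            rw [← Real.mul_rpow hn.le hpos, ← hsplit]
        _ ≤ ((n + 1 : ℕ) : ℝ) ^ c * (1 + c * -(((n + 1 : ℕ) : ℝ))⁻¹) := by gcongr
        _ = _ := by rw [Real.rpow_sub_one hn.ne']; ring
    calc _ ≤ c⁻¹ * (n : ℝ) ^ c + ((n + 1 : ℕ) : ℝ) ^ (c - 1) := by gcongr
      _ ≤ c⁻¹ * (((n + 1 : ℕ) : ℝ) ^ c - c * ((n + 1 : ℕ) : ℝ) ^ (c - 1)) +
          ((n + 1 : ℕ) : ℝ) ^ (c - 1) := by gcongr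
      _ = _ := by field_simp; ring

lemma Nat.Prime.eq_and_eq_of_sq_mul_cube_eq {q r s t : ℕ} (hq : q.Prime) (hr : r.Prime)
    (hs : s.Prime) (ht : t.Prime) (h : q ^ 2 * r ^ 3 = s ^ 2 * t ^ 3) : q = s ∧ r = t := by
  have hrt : r = t := by
    by_contra hne
    have hf := congrArg (fun m => m.factorization r) h
    simp only [Nat.factorization_mul (pow_ne_zero _ hq.ne_zero) (pow_ne_zero _ hr.ne_zero),
      Nat.factorization_mul (pow_ne_zero _ hs.ne_zero) (pow_ne_zero _ ht.ne_zero),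
      hq.factorization_pow, hr.factorization_pow, hs.factorization_pow, ht.factorization_pow,
      Finsupp.add_apply, Finsupp.single_apply, if_neg (Ne.symm hne)] at hf
    split_ifs at hf <;> omega
  subst hrt
  exact ⟨Nat.pow_left_injective two_ne_zero
    (Nat.eq_of_mul_eq_mul_right (pow_pos hr.pos 3) h), rfl⟩

open Classical in
/-- A sum over `S` unfolds as a double sum over primes. -/
lemma sum_ite_memS_eq (f : ℕ → ℂ) (x : ℝ) (hx : 0 ≤ x) :
    ∑ m ∈ Finset.Icc 1 ⌊x⌋₊, (if memS m then f m else 0) =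
      ∑ r ∈ (Finset.Icc 1 ⌊x ^ ((1 : ℝ) / 3)⌋₊).filter Nat.Prime,
        ∑ q ∈ (Finset.Icc 1 ⌊(x / (r : ℝ) ^ 3) ^ ((1 : ℝ) / 2)⌋₊).filter Nat.Prime,
          f (q ^ 2 * r ^ 3) := by
  have hq_iff : ∀ q r : ℕ, r.Prime → ((q : ℝ) ≤ (x / (r : ℝ) ^ 3) ^ ((1 : ℝ) / 2) ↔
      ((q ^ 2 * r ^ 3 : ℕ) : ℝ) ≤ x) := by
    intro q r hr
    have hr0 : (0 : ℝ) < (r : ℝ) ^ 3 := by exact pow_pos (by exact_mod_cast hr.pos) 3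
    rw [← Real.sqrt_eq_rpow, Real.le_sqrt (by positivity) (div_nonneg hx hr0.le), le_div_iff₀ hr0]
    push_cast
    rfl
  have hr_of : ∀ q r : ℕ, q.Prime → ((q ^ 2 * r ^ 3 : ℕ) : ℝ) ≤ x →
      (r : ℝ) ≤ x ^ ((1 : ℝ) / 3) := by
    intro q r hq h
    have h1 : ((r : ℝ)) ^ (3 : ℝ) ≤ x := by
      refine le_trans ?_ h
      norm_cast
      exact Nat.le_mul_of_pos_left _ (pow_pos hq.pos 2)
    rw [one_div]
    exact (Real.le_rpow_inv_iff_of_pos (by positivity) hx (by norm_num)).2 h1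
  rw [← Finset.sum_filter, Finset.sum_sigma']
  symm
  refine Finset.sum_bij (fun a _ => a.2 ^ 2 * a.1 ^ 3) ?_ ?_ ?_ ?_
  · rintro ⟨r, q⟩ h
    simp only [Finset.mem_sigma, Finset.mem_filter, Finset.mem_Icc] at h ⊢
    obtain ⟨⟨-, hr⟩, ⟨-, hqx⟩, hq⟩ := h
    have hqx := (Nat.le_floor_iff (by positivity)).1 hqx
    exact ⟨⟨Nat.mul_pos (pow_pos hq.pos 2) (pow_pos hr.pos 3),
      Nat.le_floor ((hq_iff q r hr).1 hqx)⟩, q, r, hq, hr, rfl⟩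
  · rintro ⟨r, q⟩ h ⟨t, s⟩ h' heq
    simp only [Finset.mem_sigma, Finset.mem_filter] at h h'
    obtain ⟨rfl, rfl⟩ := h.2.2.eq_and_eq_of_sq_mul_cube_eq h.1.2 h'.2.2 h'.1.2 heq
    rfl
  · rintro m hm
    simp only [Finset.mem_filter, Finset.mem_Icc] at hm
    obtain ⟨⟨-, hmx⟩, q, r, hq, hr, rfl⟩ := hm
    have hmx := (Nat.le_floor_iff hx).1 hmx
    refine ⟨⟨r, q⟩, ?_, rfl⟩
    simp only [Finset.mem_sigma, Finset.mem_filter, Finset.mem_Icc]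
    exact ⟨⟨⟨hr.pos, Nat.le_floor (hr_of q r hq hmx)⟩, hr⟩,
      ⟨hq.pos, Nat.le_floor ((hq_iff q r hr).2 hmx)⟩, hq⟩
  · intros; rfl

end

open Classical in
/-- Lemma 6: under GRH mod `p`, for `χ` mod `p` with `χ² ≠ χ₀`, the sum of `χ` over members
of `S` up to `x` is `O(x^(1/3) (log(px))²)`. -/
theorem S_char_sum_higher_order_GRH :
    ∃ C : ℝ, 0 < C ∧ ∀ (p : ℕ) [Fact p.Prime], Odd p →
      ∀ χ : DirichletCharacter ℂ p, χ ^ 2 ≠ 1 →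
      (∀ ψ : DirichletCharacter ℂ p, ∀ s : ℂ,
        DirichletCharacter.LFunction ψ s = 0 → 0 < s.re → s.re < 1 → s.re = 1/2) →
      ∀ x : ℝ, 2 ≤ x →
        ‖∑ m ∈ Finset.Icc 1 ⌊x⌋₊, if memS m then χ (m : ZMod p) else 0‖
          ≤ C * x ^ ((1 : ℝ)/3) * (Real.log ((p : ℝ) * x)) ^ 2 := by
  obtain ⟨C, hC, hprime⟩ := DirichletCharacter.exists_norm_sum_prime_le
  refine ⟨16 * C, by positivity, fun p _ hodd χ hχ hGRH x hx => ?_⟩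
  have hp3 : 3 ≤ p := by
    have h2 := (Fact.out : p.Prime).two_le
    have : p ≠ 2 := by rintro rfl; exact absurd hodd (by decide)
    omega
  have hx0 : 0 < x := by linarith
  have hp3r : (3 : ℝ) ≤ p := by exact_mod_cast hp3
  have hnz : ∀ s : ℂ, 1 / 2 < s.re → (χ ^ 2).LFunction s ≠ 0 := by
    intro s hs h0
    rcases lt_or_ge s.re 1 with h1 | h1
    · exact hs.ne' (hGRH _ s h0 (by linarith) h1)
    · exact DirichletCharacter.LFunction_ne_zero_of_one_le_re _ (Or.inl hχ) h1 h0
  have hlog_le : Real.log p ≤ Real.log (p * x) :=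
    Real.log_le_log (by linarith) (by nlinarith)
  have hlog_one : 1 ≤ Real.log p := by
    rw [Real.le_log_iff_exp_le (by linarith)]
    linarith [Real.exp_one_lt_d9]
  have hinner : ∀ r ∈ (Finset.Icc 1 ⌊x ^ ((1 : ℝ) / 3)⌋₊).filter Nat.Prime,
      ‖∑ q ∈ (Finset.Icc 1 ⌊(x / (r : ℝ) ^ 3) ^ ((1 : ℝ) / 2)⌋₊).filter Nat.Prime,
        χ ((q ^ 2 * r ^ 3 : ℕ) : ZMod p)‖ ≤
      C * Real.log p * x ^ ((5 : ℝ) / 16) * (r : ℝ) ^ ((1 / 16 : ℝ) - 1) := by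
    intro r hr
    simp only [Finset.mem_filter, Finset.mem_Icc] at hr
    have hr0 : (0 : ℝ) < r := by exact_mod_cast hr.2.pos
    have hrx : (r : ℝ) ^ 3 ≤ x := by
      have h1 := (Nat.le_floor_iff (by positivity)).1 hr.1.2
      rw [one_div, Real.le_rpow_inv_iff_of_pos hr0.le hx0.le (by norm_num)] at h1
      exact_mod_cast h1
    have hy : 1 ≤ (x / (r : ℝ) ^ 3) ^ ((1 : ℝ) / 2) :=
      Real.one_le_rpow ((one_le_div (by positivity)).2 hrx) (by norm_num)
    have hfactor : ∀ q : ℕ, χ ((q ^ 2 * r ^ 3 : ℕ) : ZMod p) =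
        χ ((r : ZMod p) ^ 3) * (χ ^ 2) (q : ZMod p) := by
      intro q
      rw [MulChar.pow_apply' _ two_ne_zero, ← map_pow, ← map_mul, mul_comm]
      push_cast
      rfl
    have hpow : ((x / (r : ℝ) ^ 3) ^ ((1 : ℝ) / 2)) ^ (5 / 8 : ℝ) =
        x ^ ((5 : ℝ) / 16) * (r : ℝ) ^ ((1 / 16 : ℝ) - 1) := by
      rw [← Real.rpow_mul (by positivity), Real.div_rpow hx0.le (by positivity),
        ← Real.rpow_natCast, ← Real.rpow_mul hr0.le, div_eq_mul_inv, ← Real.rpow_neg hr0.le]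
      norm_num
    simp_rw [hfactor]
    rw [← Finset.mul_sum, norm_mul]
    refine (mul_le_of_le_one_left (norm_nonneg _) (χ.norm_le_one _)).trans ?_
    refine (hprime p hp3 _ hχ hnz _ hy).trans (le_of_eq ?_)
    rw [hpow]
    ring
  rw [sum_ite_memS_eq (fun m => χ (m : ZMod p)) x hx0.le]
  set R := ⌊x ^ ((1 : ℝ) / 3)⌋₊ with hR
  have hRx : (R : ℝ) ^ (1 / 16 : ℝ) ≤ x ^ ((1 : ℝ) / 48) := by
    calc (R : ℝ) ^ (1 / 16 : ℝ) ≤ (x ^ ((1 : ℝ) / 3)) ^ (1 / 16 : ℝ) := by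
          gcongr
          exact Nat.floor_le (by positivity)
      _ = _ := by rw [← Real.rpow_mul hx0.le]; norm_num
  have hsum := sum_Icc_rpow_le (c := 1 / 16) (by norm_num) (by norm_num) R
  calc _ ≤ ∑ r ∈ (Finset.Icc 1 R).filter Nat.Prime,
          C * Real.log p * x ^ ((5 : ℝ) / 16) * (r : ℝ) ^ ((1 / 16 : ℝ) - 1) :=
        norm_sum_le_of_le _ hinner
    _ ≤ ∑ r ∈ Finset.Icc 1 R,
          C * Real.log p * x ^ ((5 : ℝ) / 16) * (r : ℝ) ^ ((1 / 16 : ℝ) - 1) :=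
        Finset.sum_le_sum_of_subset_of_nonneg (Finset.filter_subset _ _)
          fun _ _ _ => by positivity
    _ ≤ C * Real.log p * x ^ ((5 : ℝ) / 16) * ((1 / 16 : ℝ)⁻¹ * x ^ ((1 : ℝ) / 48)) := by
        rw [← Finset.mul_sum]
        gcongr
        exact hsum.trans (by gcongr)
    _ = 16 * C * x ^ ((1 : ℝ) / 3) * Real.log p := by
        rw [show (1 : ℝ) / 3 = 5 / 16 + 1 / 48 by norm_num, Real.rpow_add hx0]
        ring
    _ ≤ 16 * C * x ^ ((1 : ℝ) / 3) * Real.log (p * x) ^ 2 := by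
        gcongr
        nlinarith
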